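/- arXiv:1202.5630 — 4 statements merged into one kernel-verified Lean document; each statement's English description precedes it below -/
import Mathlib

section
/- For every τ in the complex upper half-plane, the Dedekind eta function satisfies the modular involution η(−1/τ) = √(−iτ)·η(τ), where √ denotes the principal branch of the square root (which is well defined since Re(−iτ) > 0). -/
/-- The Dedekind eta function `η(τ) = q^{1/24} ∏_{m≥1} (1 - q^m)` with
`q = exp(2πiτ)`, defined for `τ` in the upper half-plane. -/
noncomputable def dedekindEta (τ : ℂ) : ℂ :=
  Complex.exp (2 * Real.pi * Complex.I * τ / 24) *
    ∏' m : ℕ, (1 - Complex.exp (2 * Real.pi * Complex.I * τ) ^ (m + 1))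

theorem dedekindEta_eq_eta : dedekindEta = ModularForm.eta := by
  ext τ
  simp [dedekindEta, ModularForm.eta, ModularForm.eta_q, Function.Periodic.qParam]

theorem neg_I_mul_cpow_half {τ : ℂ} (hτ : 0 < τ.im) :
    (-Complex.I * τ) ^ ((1 : ℂ) / 2) = (Complex.sqrt Complex.I)⁻¹ * Complex.sqrt τ := by
  have hτ0 : τ ≠ 0 := by
    rintro rfl
    simp at hτ
  have harg : 0 ≤ τ.arg := Complex.arg_nonneg_iff.mpr hτ.le
  have hlog : Complex.log (-Complex.I * τ) = Complex.log (-Complex.I) + Complex.log τ := by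
    refine Complex.log_mul (neg_ne_zero.mpr Complex.I_ne_zero) hτ0 ?_
    rw [Complex.arg_neg_I]
    constructor <;> linarith [Real.pi_pos, Complex.arg_le_pi τ]
  rw [Complex.cpow_def_of_ne_zero (by simp [hτ0]), hlog, sqrt_eq_exp Complex.I_ne_zero,
    sqrt_eq_exp hτ0, ← Complex.exp_neg, ← Complex.exp_add, Complex.log_neg_I,
    Complex.log_I]
  ring_nf

/-- The modular involution of the Dedekind eta function:
`η(-1/τ) = √(-iτ) · η(τ)`, with the principal branch of the square root. -/
theorem eta_modular_involution (τ : ℂ) (hτ : 0 < τ.im) :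
    dedekindEta (-1 / τ) = (-Complex.I * τ) ^ ((1 : ℂ) / 2) * dedekindEta τ := by
  have h := ModularForm.eta_comp_eq_csqrt_I_inv hτ
  simp only [Function.comp_apply, Pi.smul_apply, Pi.mul_apply, smul_eq_mul] at h
  rw [dedekindEta_eq_eta, h, neg_I_mul_cpow_half hτ, mul_assoc]
end

section
/- For every real q with 0 < q < 1, one has Σ_{m≥1, n≥1, m odd, n odd} q^{mn}/n = −(1/2)·log ∏_{m=1}^∞ (1 − q^m)²(1 − q^{4m})/(1 − q^{2m})³, where the infinite product on the right-hand side is a positive real number. Equivalently, Σ_{m,n≥1} (2q^{mn} − 3q^{2mn} + q^{4mn})/(2n) evaluates to the stated logarithm with opposite sign. -/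
/-- Tonelli for `HasSum`: a nonnegative double family may be summed along its rows. -/
theorem hasSum_prod_of_nonneg_of_rows {f : ℕ × ℕ → ℝ} {g : ℕ → ℝ} {s : ℝ} (hf : 0 ≤ f)
    (hrow : ∀ m, HasSum (fun n => f (m, n)) (g m)) (hg : HasSum g s) : HasSum f s := by
  have hsum : Summable f := by
    rw [summable_prod_of_nonneg hf]
    refine ⟨fun m => (hrow m).summable, ?_⟩
    simpa only [(hrow _).tsum_eq] using hg.summable
  have h := hsum.hasSum.prod_fiberwise hrow
  rw [hg.unique h]
  exact hsum.hasSum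

theorem summable_log_one_sub_pow {x : ℝ} (hx0 : 0 < x) (hx1 : x < 1) :
    Summable fun m : ℕ => Real.log (1 - x ^ (m + 1)) := by
  have h : Summable fun m : ℕ => -x ^ (m + 1) :=
    ((summable_nat_add_iff 1).2 (summable_geometric_of_lt_one hx0.le hx1)).neg
  simpa only [← sub_eq_add_neg] using Real.summable_log_one_add_of_summable h

/-- The logarithm of Euler's product `∏_{m ≥ 1} (1 - x ^ m)` as a Lambert-type double series. -/
theorem hasSum_lambert_log {x : ℝ} (hx0 : 0 < x) (hx1 : x < 1) :
    HasSum (fun p : ℕ × ℕ => x ^ ((p.1 + 1) * (p.2 + 1)) / ((p.2 : ℝ) + 1))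
      (-∑' m : ℕ, Real.log (1 - x ^ (m + 1))) := by
  refine hasSum_prod_of_nonneg_of_rows (g := fun m => -Real.log (1 - x ^ (m + 1)))
    (fun p => by simp only [Pi.zero_apply]; positivity) (fun m => ?_)
    (summable_log_one_sub_pow hx0 hx1).hasSum.neg
  have habs : |x ^ (m + 1)| < 1 := by
    rw [abs_of_pos (by positivity)]
    exact pow_lt_one₀ hx0.le hx1 (by simp)
  simpa only [pow_mul] using Real.hasSum_pow_div_log_of_abs_lt_one habs

theorem hasSum_log_one_sub_odd_pow {x : ℝ} (hx0 : 0 < x) (hx1 : x < 1) :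
    HasSum (fun m : ℕ => Real.log (1 - x ^ (2 * m + 1)))
      ((∑' m : ℕ, Real.log (1 - x ^ (m + 1))) - ∑' m : ℕ, Real.log (1 - (x ^ 2) ^ (m + 1))) := by
  have hs := summable_log_one_sub_pow hx0 hx1
  have he : Summable fun m : ℕ => Real.log (1 - x ^ (2 * m + 1)) :=
    hs.comp_injective (i := fun m => 2 * m) fun a b hab => by simpa using hab
  have ho : Summable fun m : ℕ => Real.log (1 - x ^ (2 * m + 1 + 1)) :=
    hs.comp_injective (i := fun m => 2 * m + 1) fun a b hab => by simpa using hab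
  have h := tsum_even_add_odd (f := fun m : ℕ => Real.log (1 - x ^ (m + 1))) he ho
  have hpow (m : ℕ) : (x ^ 2) ^ (m + 1) = x ^ (2 * m + 1 + 1) := by
    rw [← pow_mul]
    congr 1
  simp only [hpow]
  rw [← h, add_sub_cancel_right]
  exact he.hasSum

/-- The odd part of the logarithmic series. -/
theorem hasSum_odd_pow_div {y : ℝ} (hy0 : 0 < y) (hy1 : y < 1) :
    HasSum (fun n : ℕ => y ^ (2 * n + 1) / (2 * (n : ℝ) + 1))
      (1 / 2 * (Real.log (1 - y ^ 2) - 2 * Real.log (1 - y))) := by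
  have h := (Real.hasSum_log_sub_log_of_abs_lt_one
    (by rwa [abs_of_pos hy0] : |y| < 1)).mul_left (1 / 2)
  have hlog : Real.log (1 - y ^ 2) = Real.log (1 + y) + Real.log (1 - y) := by
    rw [← Real.log_mul (by linarith) (by linarith)]
    congr 1
    ring
  convert h using 1
  · rfl
  · funext n
    ring
  · rw [hlog]
    ring

theorem hasSum_odd_lambert {q : ℝ} (hq0 : 0 < q) (hq1 : q < 1) :
    HasSum (fun p : ℕ × ℕ => q ^ ((2 * p.1 + 1) * (2 * p.2 + 1)) / (2 * (p.2 : ℝ) + 1))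
      (-(1 / 2) * (2 * (∑' m : ℕ, Real.log (1 - q ^ (m + 1)))
        + (∑' m : ℕ, Real.log (1 - (q ^ 4) ^ (m + 1)))
        - 3 * ∑' m : ℕ, Real.log (1 - (q ^ 2) ^ (m + 1)))) := by
  have h1 := hasSum_log_one_sub_odd_pow hq0 hq1
  have h2 := hasSum_log_one_sub_odd_pow (pow_pos hq0 2) (pow_lt_one₀ hq0.le hq1 two_ne_zero)
  refine hasSum_prod_of_nonneg_of_rows
    (g := fun m => 1 / 2 * (Real.log (1 - (q ^ 2) ^ (2 * m + 1))
      - 2 * Real.log (1 - q ^ (2 * m + 1))))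
    (fun p => by simp only [Pi.zero_apply]; positivity) (fun m => ?_) ?_
  · have h := hasSum_odd_pow_div (pow_pos hq0 (2 * m + 1)) (pow_lt_one₀ hq0.le hq1 (by simp))
    rw [pow_right_comm q (2 * m + 1) 2] at h
    simpa only [pow_mul q (2 * m + 1)] using h
  · convert (h2.sub (h1.mul_left 2)).mul_left (1 / 2) using 1
    · rfl
    · rw [show (q ^ 2) ^ 2 = q ^ 4 by ring]
      ring

theorem hasSum_log_eta_quotient_factor {q : ℝ} (hq0 : 0 < q) (hq1 : q < 1) :
    HasSum (fun m : ℕ => Real.log ((1 - q ^ (m + 1)) ^ 2 * (1 - q ^ (4 * (m + 1))) /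
        (1 - q ^ (2 * (m + 1))) ^ 3))
      (2 * (∑' m : ℕ, Real.log (1 - q ^ (m + 1)))
        + (∑' m : ℕ, Real.log (1 - (q ^ 4) ^ (m + 1)))
        - 3 * ∑' m : ℕ, Real.log (1 - (q ^ 2) ^ (m + 1))) := by
  have hsum (k : ℕ) (hk : k ≠ 0) :=
    (summable_log_one_sub_pow (pow_pos hq0 k) (pow_lt_one₀ hq0.le hq1 hk)).hasSum
  have hne (k : ℕ) (hk : k ≠ 0) : 1 - q ^ k ≠ 0 :=
    (sub_pos.2 (pow_lt_one₀ hq0.le hq1 hk)).ne'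
  convert (((summable_log_one_sub_pow hq0 hq1).hasSum.mul_left 2).add
    (hsum 4 (by simp))).sub ((hsum 2 (by simp)).mul_left 3) using 2 with m
  · rfl
  have h1 := hne (m + 1) (by simp)
  have h2 := hne (2 * (m + 1)) (by simp)
  have h4 := hne (4 * (m + 1)) (by simp)
  rw [Real.log_div (mul_ne_zero (pow_ne_zero 2 h1) h4) (pow_ne_zero 3 h2),
    Real.log_mul (pow_ne_zero 2 h1) h4, Real.log_pow, Real.log_pow, pow_mul, pow_mul]
  norm_num

/-- For real `0 < q < 1`:
`Σ_{m,n≥1 odd} q^{mn}/n = -(1/2)·log ∏_{m≥1} (1-q^m)²(1-q^{4m})/(1-q^{2m})³`,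
the infinite product being a positive real number; equivalently,
`Σ_{m,n≥1} (2q^{mn} - 3q^{2mn} + q^{4mn})/(2n)` evaluates to the same quantity. -/
theorem odd_lambert_log_identity (q : ℝ) (hq0 : 0 < q) (hq1 : q < 1) :
    (0 < ∏' m : ℕ, (1 - q ^ (m + 1)) ^ 2 * (1 - q ^ (4 * (m + 1))) /
        (1 - q ^ (2 * (m + 1))) ^ 3) ∧
    (∑' p : ℕ × ℕ, q ^ ((2 * p.1 + 1) * (2 * p.2 + 1)) / (2 * (p.2 : ℝ) + 1)
      = -(1 / 2) * Real.log (∏' m : ℕ, (1 - q ^ (m + 1)) ^ 2 * (1 - q ^ (4 * (m + 1))) /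
          (1 - q ^ (2 * (m + 1))) ^ 3)) ∧
    (∑' p : ℕ × ℕ, (2 * q ^ ((p.1 + 1) * (p.2 + 1)) - 3 * q ^ (2 * ((p.1 + 1) * (p.2 + 1)))
          + q ^ (4 * ((p.1 + 1) * (p.2 + 1)))) / (2 * ((p.2 : ℝ) + 1))
      = -(1 / 2) * Real.log (∏' m : ℕ, (1 - q ^ (m + 1)) ^ 2 * (1 - q ^ (4 * (m + 1))) /
          (1 - q ^ (2 * (m + 1))) ^ 3)) := by
  have hfac (m : ℕ) : 0 < (1 - q ^ (m + 1)) ^ 2 * (1 - q ^ (4 * (m + 1))) /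
      (1 - q ^ (2 * (m + 1))) ^ 3 := by
    have h (k : ℕ) (hk : k ≠ 0) : 0 < 1 - q ^ k := sub_pos.2 (pow_lt_one₀ hq0.le hq1 hk)
    exact div_pos (mul_pos (pow_pos (h _ (by simp)) 2) (h _ (by simp))) (pow_pos (h _ (by simp)) 3)
  have hlog := hasSum_log_eta_quotient_factor hq0 hq1
  rw [← Real.rexp_tsum_eq_tprod hfac hlog.summable, Real.log_exp, hlog.tsum_eq]
  refine ⟨Real.exp_pos _, (hasSum_odd_lambert hq0 hq1).tsum_eq, ?_⟩
  have h1 := hasSum_lambert_log hq0 hq1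
  have h2 := hasSum_lambert_log (pow_pos hq0 2) (pow_lt_one₀ hq0.le hq1 two_ne_zero)
  have h4 := hasSum_lambert_log (pow_pos hq0 4) (pow_lt_one₀ hq0.le hq1 four_ne_zero)
  convert ((h1.add (h4.mul_left (1 / 2))).sub (h2.mul_left (3 / 2))).tsum_eq using 1
  · refine tsum_congr fun p => ?_
    rw [pow_mul q 2, pow_mul q 4]
    field_simp
    ring
  · ring
end

section
/- Define x(τ) := η(2τ)⁴η(8τ)²/η(4τ)⁶. For every τ in the upper half-plane lying on the positive imaginary axis (τ = it, t > 0), writing x′(τ) for the complex derivative of x at τ, one has the differential identity (1/(2πi)) · x(τ)·x′(τ)/(2·√(1 − x(τ)⁴)) = − η(2τ)⁴η(8τ)⁴/η(4τ)⁴, where √(1 − x(τ)⁴) denotes the positive real square root (well defined since 0 < x(it) < 1). -/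
/-- The modular function `x(τ) = η(2τ)⁴η(8τ)²/η(4τ)⁶`. -/
noncomputable def xFun (τ : ℂ) : ℂ :=
  dedekindEta (2 * τ) ^ 4 * dedekindEta (8 * τ) ^ 2 / dedekindEta (4 * τ) ^ 6

open Filter Topology

/-- The theta series `∑_{n ∈ ℤ} q^{n²}` as a function of a real nome `q`. -/
noncomputable def thetaReal (q : ℝ) : ℝ := ∑' n : ℤ, q ^ (n.natAbs ^ 2)

lemma summable_natAbs_sq_mul_pow {r : ℝ} (h0 : 0 ≤ r) (h1 : r < 1) :
    Summable fun n : ℤ ↦ (n.natAbs : ℝ) ^ 2 * r ^ (n.natAbs - 1) := by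
  have h : Summable fun n : ℕ ↦ (n : ℝ) ^ 2 * r ^ (n - 1) := by
    rw [← summable_nat_add_iff 1]
    have := (summable_nat_add_iff 1).2
      (summable_pow_mul_geometric_of_norm_lt_one (R := ℝ) 2 (r := r)
        (by rwa [Real.norm_of_nonneg h0]))
    rcases h0.eq_or_lt with rfl | h0
    · refine summable_of_ne_finset_zero (s := {0}) fun n hn ↦ ?_
      have : n ≠ 0 := by simpa using hn
      simp [this]
    · refine (this.div_const r).congr fun n ↦ ?_
      rw [Nat.add_sub_cancel, pow_succ r n]
      field_simp
  exact Summable.of_nat_of_neg (by simpa using h) (by simpa using h)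

lemma summable_norm_pow_natAbs_sq {q : ℝ} (hq : |q| < 1) :
    Summable fun n : ℤ ↦ ‖q ^ (n.natAbs ^ 2)‖ := by
  have h : Summable fun n : ℕ ↦ |q| ^ n ^ 2 :=
    (summable_geometric_of_lt_one (abs_nonneg q) hq).of_nonneg_of_le (fun n ↦ by positivity)
      fun n ↦ pow_le_pow_of_le_one (abs_nonneg q) hq.le (Nat.le_self_pow two_ne_zero n)
  exact Summable.of_nat_of_neg (by simpa using h) (by simpa using h)

/-- The termwise derivative of the theta series. -/
noncomputable def thetaRealDeriv (q : ℝ) : ℝ :=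
  ∑' n : ℤ, ((n.natAbs ^ 2 : ℕ) : ℝ) * q ^ (n.natAbs ^ 2 - 1)

lemma norm_thetaRealDeriv_term_le {r q : ℝ} (hr : r < 1) (hq : |q| < r) (n : ℤ) :
    ‖((n.natAbs ^ 2 : ℕ) : ℝ) * q ^ (n.natAbs ^ 2 - 1)‖ ≤
      (n.natAbs : ℝ) ^ 2 * r ^ (n.natAbs - 1) := by
  have hr0 : 0 ≤ r := (abs_nonneg q).trans hq.le
  rw [norm_mul, norm_pow, Real.norm_eq_abs q, Real.norm_of_nonneg (by positivity)]
  push_cast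
  gcongr
  calc |q| ^ (n.natAbs ^ 2 - 1) ≤ r ^ (n.natAbs ^ 2 - 1) := by gcongr
    _ ≤ r ^ (n.natAbs - 1) := pow_le_pow_of_le_one hr0 hr.le
      (Nat.sub_le_sub_right (Nat.le_self_pow two_ne_zero _) 1)

lemma hasDerivAt_thetaReal {q : ℝ} (hq : |q| < 1) :
    HasDerivAt thetaReal (thetaRealDeriv q) q := by
  obtain ⟨r, hqr, hr⟩ := exists_between hq
  have hr0 : 0 < r := (abs_nonneg q).trans_lt hqr
  have hmem : ∀ y, y ∈ Metric.ball (0 : ℝ) r ↔ |y| < r := by simp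
  exact hasDerivAt_tsum_of_isPreconnected (summable_natAbs_sq_mul_pow hr0.le hr)
    Metric.isOpen_ball (convex_ball (0 : ℝ) r).isPreconnected
    (fun n y _ ↦ hasDerivAt_pow (n.natAbs ^ 2) y)
    (fun n y hy ↦ norm_thetaRealDeriv_term_le hr ((hmem y).1 hy) n)
    (Metric.mem_ball_self hr0) (summable_norm_pow_natAbs_sq (by simp)).of_norm ((hmem q).2 hqr)

lemma continuousAt_thetaRealDeriv_zero : ContinuousAt thetaRealDeriv 0 := by
  refine ContinuousOn.continuousAt (s := Metric.ball (0 : ℝ) (1 / 2)) ?_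
    (Metric.ball_mem_nhds _ (by norm_num))
  exact continuousOn_tsum (fun n ↦ by fun_prop)
    (summable_natAbs_sq_mul_pow (r := 1 / 2) (by norm_num) (by norm_num))
    fun n y hy ↦ norm_thetaRealDeriv_term_le (by norm_num) (by simpa using hy) n

lemma thetaReal_zero : thetaReal 0 = 1 := by
  rw [thetaReal, tsum_eq_single 0]
  · simp
  · intro n hn
    simp [hn]

lemma thetaRealDeriv_zero : thetaRealDeriv 0 = 2 := by
  rw [thetaRealDeriv, tsum_eq_sum (s := {1, -1})]
  · norm_num
  · intro n hn
    have h : n.natAbs ≠ 1 := by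
      simp only [Finset.mem_insert, Finset.mem_singleton] at hn
      omega
    rcases Nat.eq_zero_or_pos n.natAbs with h0 | h0
    · simp [h0]
    · have : n.natAbs ^ 2 - 1 ≠ 0 := by
        have : 2 ^ 2 ≤ n.natAbs ^ 2 := Nat.pow_le_pow_left (by omega) 2
        omega
      simp [zero_pow this]

lemma neg_pow_natAbs_sq (q : ℝ) (n : ℤ) :
    (-q) ^ (n.natAbs ^ 2) = (if Even n then 1 else -1) * q ^ (n.natAbs ^ 2) := by
  split_ifs with h
  · rw [Even.neg_pow ((Int.natAbs_even.2 h).pow_of_ne_zero two_ne_zero), one_mul]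
  · rw [Odd.neg_pow (Int.natAbs_odd.2 (Int.not_even_iff_odd.1 h)).pow, neg_one_mul]

lemma pow_natAbs_add_sq_mul (q : ℝ) (a b : ℤ) :
    q ^ ((a + b).natAbs ^ 2) * q ^ ((a - b).natAbs ^ 2) =
      (q ^ 2) ^ (a.natAbs ^ 2) * (q ^ 2) ^ (b.natAbs ^ 2) := by
  simp only [← pow_mul, ← pow_add]
  congr 1
  zify
  simp only [sq_abs]
  ring

/-- A double series supported on pairs of equal parity can be reindexed by sum and difference. -/
lemma tsum_add_sub_of_support (g : ℤ × ℤ → ℝ) (hg : ∀ m n : ℤ, ¬ (Even m ↔ Even n) → g (m, n) = 0) :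
    ∑' p : ℤ × ℤ, g (p.1 + p.2, p.1 - p.2) = ∑' p, g p := by
  have hinj : Function.Injective fun p : ℤ × ℤ ↦ (p.1 + p.2, p.1 - p.2) := by
    rintro ⟨a, b⟩ ⟨c, d⟩ h
    simp only [Prod.mk.injEq] at h ⊢
    omega
  refine hinj.tsum_eq (f := g) ?_
  rintro ⟨m, n⟩ hmn
  have h : Even m ↔ Even n := by
    by_contra h
    exact hmn (hg m n h)
  rw [Int.even_iff, Int.even_iff] at h
  exact ⟨((m + n) / 2, (m - n) / 2), by ext <;> simp <;> omega⟩

lemma abs_sq_lt_one {q : ℝ} (hq : |q| < 1) : |q ^ 2| < 1 := by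
  rw [abs_pow]
  exact pow_lt_one₀ (abs_nonneg q) hq two_ne_zero

lemma thetaReal_sq_add_sq {q : ℝ} (hq : |q| < 1) :
    thetaReal q ^ 2 + thetaReal (-q) ^ 2 = 2 * thetaReal (q ^ 2) ^ 2 := by
  have h1 := summable_norm_pow_natAbs_sq hq
  have h2 := summable_norm_pow_natAbs_sq (q := -q) (by rwa [abs_neg])
  have h3 := summable_norm_pow_natAbs_sq (abs_sq_lt_one hq)
  simp only [thetaReal, sq (tsum _)]
  rw [tsum_mul_tsum_of_summable_norm h1 h1, tsum_mul_tsum_of_summable_norm h2 h2,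
    tsum_mul_tsum_of_summable_norm h3 h3,
    ← (summable_mul_of_summable_norm h1 h1).tsum_add (summable_mul_of_summable_norm h2 h2),
    ← tsum_add_sub_of_support, ← tsum_mul_left]
  · refine tsum_congr fun p ↦ ?_
    simp only [neg_pow_natAbs_sq, ← pow_natAbs_add_sq_mul, Int.even_add, Int.even_sub]
    split_ifs <;> ring
  · intro m n h
    simp only [neg_pow_natAbs_sq]
    split_ifs <;> first | tauto | ring

lemma thetaReal_mul_neg {q : ℝ} (hq : |q| < 1) :
    thetaReal q * thetaReal (-q) = thetaReal (-q ^ 2) ^ 2 := by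
  have h1 := summable_norm_pow_natAbs_sq hq
  have h2 := summable_norm_pow_natAbs_sq (q := -q) (by rwa [abs_neg])
  have h3 := summable_norm_pow_natAbs_sq (q := -q ^ 2) (by rw [abs_neg]; exact abs_sq_lt_one hq)
  suffices h : thetaReal q * thetaReal (-q) + thetaReal (-q) * thetaReal q =
      2 * thetaReal (-q ^ 2) ^ 2 by linarith
  simp only [thetaReal, sq (tsum _)]
  rw [tsum_mul_tsum_of_summable_norm h1 h2, tsum_mul_tsum_of_summable_norm h2 h1,
    tsum_mul_tsum_of_summable_norm h3 h3,
    ← (summable_mul_of_summable_norm h1 h2).tsum_add (summable_mul_of_summable_norm h2 h1),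
    ← tsum_add_sub_of_support, ← tsum_mul_left]
  · refine tsum_congr fun p ↦ ?_
    have := pow_natAbs_add_sq_mul q p.1 p.2
    simp only [neg_pow_natAbs_sq, Int.even_add, Int.even_sub]
    split_ifs <;> first | tauto | linarith
  · intro m n h
    simp only [neg_pow_natAbs_sq]
    split_ifs <;> first | tauto | ring

lemma thetaReal_neg_lt {q : ℝ} (h0 : 0 < q) (h1 : q < 1) : thetaReal (-q) < thetaReal q := by
  have hq : |q| < 1 := by rwa [abs_of_pos h0]
  refine Summable.tsum_lt_tsum (i := 1) (fun n ↦ ?_) (by simp; linarith)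
    (summable_norm_pow_natAbs_sq (q := -q) (by rwa [abs_neg])).of_norm
    (summable_norm_pow_natAbs_sq hq).of_norm
  rw [neg_pow_natAbs_sq]
  have : 0 < q ^ (n.natAbs ^ 2) := by positivity
  split_ifs <;> linarith

/-- The Euler product `∏_{m ≥ 1} (1 - q^m)` at a real nome `q`. -/
noncomputable def eulerReal (q : ℝ) : ℝ := ∏' m : ℕ, (1 - q ^ (m + 1))

lemma multipliable_one_sub_pow_real {q : ℝ} (hq : |q| < 1) :
    Multipliable fun m : ℕ ↦ 1 - q ^ (m + 1) := by
  apply multipliable_one_add_of_summable (f := fun m ↦ -q ^ (m + 1))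
  simpa using (summable_nat_add_iff 1).mpr (summable_geometric_of_lt_one (abs_nonneg _) hq)

lemma ofReal_eulerReal {q : ℝ} (hq : |q| < 1) :
    (eulerReal q : ℂ) = ∏' m : ℕ, (1 - (q : ℂ) ^ (m + 1)) := by
  rw [eulerReal]
  simpa using (multipliable_one_sub_pow_real hq).map_tprod Complex.ofRealHom
    Complex.continuous_ofReal

lemma eulerReal_pos {q : ℝ} (h0 : 0 < q) (h1 : q < 1) : 0 < eulerReal q := by
  have hq : |q| < 1 := by rwa [abs_of_pos h0]
  have hpos (m : ℕ) : 0 < 1 - q ^ (m + 1) := sub_pos.2 (pow_lt_one₀ h0.le h1 m.succ_ne_zero)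
  refine lt_of_le_of_ne ?_ (Ne.symm ?_)
  · exact ge_of_tendsto' (multipliable_one_sub_pow_real hq).hasProd.tendsto_prod_nat
      fun n ↦ Finset.prod_nonneg fun m _ ↦ (hpos m).le
  · refine tprod_one_add_ne_zero_of_summable (f := fun m ↦ -q ^ (m + 1)) (fun m ↦ ?_) ?_
    · simpa [← sub_eq_add_neg] using (hpos m).ne'
    · simpa using (summable_nat_add_iff 1).mpr (summable_geometric_of_lt_one (abs_nonneg _) hq)

lemma eulerReal_zero : eulerReal 0 = 1 := by
  simp [eulerReal]

lemma continuousAt_eulerReal_zero : ContinuousAt eulerReal 0 := by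
  have h : ContinuousAt (fun q : ℂ ↦ ∏' m : ℕ, (1 - q ^ (m + 1))) ((0 : ℝ) : ℂ) :=
    (ModularForm.differentiableOn_tprod_one_sub_pow.differentiableAt
      (Metric.ball_mem_nhds _ (by simp))).continuousAt
  refine (Complex.continuous_re.continuousAt.comp
    (h.comp Complex.continuous_ofReal.continuousAt)).congr ?_
  filter_upwards [Metric.ball_mem_nhds (0 : ℝ) one_pos] with q hq
  have hq : |q| < 1 := by simpa using hq
  simp only [Function.comp_apply, ← ofReal_eulerReal hq, Complex.ofReal_re]

/-- The partial products of `∏ (1 - q^m) / (1 + q^m)`. -/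
noncomputable def gaussProd (q : ℝ) (n : ℕ) : ℝ :=
  ∏ m ∈ Finset.range n, (1 - q ^ (m + 1)) / (1 + q ^ (m + 1))

lemma gaussProd_succ (q : ℝ) (n : ℕ) :
    gaussProd q (n + 1) = gaussProd q n * ((1 - q ^ (n + 1)) / (1 + q ^ (n + 1))) :=
  Finset.prod_range_succ _ _

lemma gaussProd_pos {q : ℝ} (h0 : 0 < q) (h1 : q < 1) (n : ℕ) : 0 < gaussProd q n :=
  Finset.prod_pos fun m _ ↦ div_pos (sub_pos.2 (pow_lt_one₀ h0.le h1 m.succ_ne_zero))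
    (by positivity)

lemma gaussProd_antitone {q : ℝ} (h0 : 0 < q) (h1 : q < 1) : Antitone (gaussProd q) := by
  refine antitone_nat_of_succ_le fun n ↦ ?_
  rw [gaussProd_succ]
  refine mul_le_of_le_one_right (gaussProd_pos h0 h1 n).le ?_
  rw [div_le_one (by positivity)]
  have : 0 < q ^ (n + 1) := by positivity
  linarith

lemma tendsto_gaussProd {q : ℝ} (h0 : 0 < q) (h1 : q < 1) :
    Tendsto (gaussProd q) atTop (𝓝 (eulerReal q ^ 2 / eulerReal (q ^ 2))) := by
  have hq : |q| < 1 := by rwa [abs_of_pos h0]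
  have hA := (multipliable_one_sub_pow_real hq).hasProd.tendsto_prod_nat
  have hB := (multipliable_one_sub_pow_real (abs_sq_lt_one hq)).hasProd.tendsto_prod_nat
  refine ((hA.pow 2).div hB
    (eulerReal_pos (pow_pos h0 2) (pow_lt_one₀ h0.le h1 two_ne_zero)).ne').congr fun n ↦ ?_
  simp only [gaussProd, ← Finset.prod_pow, Pi.div_apply, ← Finset.prod_div_distrib]
  refine Finset.prod_congr rfl fun m _ ↦ ?_
  have h2 : 0 < 1 - q ^ (m + 1) := sub_pos.2 (pow_lt_one₀ h0.le h1 m.succ_ne_zero)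
  have h3 : 1 - (q ^ 2) ^ (m + 1) = (1 - q ^ (m + 1)) * (1 + q ^ (m + 1)) := by ring
  rw [h3]
  field_simp

/-- The summand of the finite form of Gauss's identity. -/
noncomputable def gaussTerm (q : ℝ) (n s : ℕ) : ℝ :=
  (-1) ^ s * (gaussProd q n / gaussProd q s) * (2 * q ^ (s * (n + 1)) / (1 + q ^ s))

lemma sum_gaussTerm_succ_sub {q : ℝ} (h0 : 0 < q) (h1 : q < 1) (n k : ℕ) :
    ∑ s ∈ Finset.range (k + 1), (gaussTerm q (n + 1) s - gaussTerm q n s) =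
      -(gaussProd q n / (1 + q ^ (n + 1))) *
        ((-1) ^ k * 2 * q ^ (n + 1) * q ^ (k * (n + 1)) / gaussProd q k) := by
  have hP := gaussProd_pos h0 h1
  induction k with
  | zero =>
    have := hP n
    have h3 := hP 0
    simp only [gaussTerm, gaussProd_succ, zero_add, Finset.sum_range_one]
    field_simp
    ring
  | succ k ih =>
    rw [Finset.sum_range_succ, ih]
    have h2 : 0 < 1 - q ^ (k + 1) := sub_pos.2 (pow_lt_one₀ h0.le h1 k.succ_ne_zero)
    have := hP n
    have h3 := hP k
    simp only [gaussTerm, gaussProd_succ]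
    field_simp
    ring

/-- The finite form of Gauss's identity. -/
lemma sum_gaussTerm {q : ℝ} (h0 : 0 < q) (h1 : q < 1) (n : ℕ) :
    ∑ s ∈ Finset.range (n + 1), gaussTerm q n s =
      ∑ k ∈ Finset.range (n + 1), 2 * (-q) ^ (k ^ 2) - 1 := by
  induction n with
  | zero => simp [gaussTerm, gaussProd]; norm_num
  | succ n ih =>
    have h := sum_gaussTerm_succ_sub h0 h1 n n
    rw [Finset.sum_sub_distrib, ih] at h
    rw [Finset.sum_range_succ, Finset.sum_range_succ _ (n + 1), eq_add_of_sub_eq h]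
    have h3 := gaussProd_pos h0 h1 n
    have h4 := gaussProd_pos h0 h1 (n + 1)
    have h5 : (-q) ^ ((n + 1) ^ 2) = (-1) ^ (n + 1) * q ^ ((n + 1) ^ 2) := by
      have := neg_pow_natAbs_sq q ((n + 1 : ℕ) : ℤ)
      simp only [Int.natAbs_natCast, Int.even_coe_nat] at this
      rw [this, neg_one_pow_eq_ite]
    rw [h5, gaussTerm, div_self h4.ne']
    field_simp
    ring

lemma abs_gaussTerm_le {q : ℝ} (h0 : 0 < q) (h1 : q < 1) {n s : ℕ} (hs : s < n) :
    |gaussTerm q n (s + 1)| ≤ 2 * q ^ n := by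
  have hP := gaussProd_pos h0 h1
  have h2 : gaussProd q n / gaussProd q (s + 1) ≤ 1 :=
    (div_le_one (hP _)).2 (gaussProd_antitone h0 h1 hs)
  have h3 : 0 ≤ gaussProd q n / gaussProd q (s + 1) := (div_pos (hP _) (hP _)).le
  rw [gaussTerm, abs_mul, abs_mul, abs_pow, abs_neg, abs_one, one_pow, one_mul, abs_of_nonneg h3,
    abs_of_nonneg (by positivity)]
  calc _ ≤ 1 * (2 * q ^ ((s + 1) * (n + 1)) / (1 + q ^ (s + 1))) := by gcongr
    _ ≤ 2 * q ^ ((s + 1) * (n + 1)) := by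
      rw [one_mul]
      exact div_le_self (by positivity) (by linarith [pow_pos h0 (s + 1)])
    _ ≤ 2 * q ^ n := by
      gcongr 2 * ?_
      exact pow_le_pow_of_le_one h0.le h1.le (by nlinarith)

/-- Gauss's identity `∑ (-1)^n q^{n²} = ∏ (1 - q^m) / (1 + q^m)`. -/
lemma thetaReal_neg_eq {q : ℝ} (h0 : 0 < q) (h1 : q < 1) :
    thetaReal (-q) = eulerReal q ^ 2 / eulerReal (q ^ 2) := by
  have hq : |-q| < 1 := by rwa [abs_neg, abs_of_pos h0]
  have hL : Tendsto (fun n ↦ ∑ k ∈ Finset.range (n + 1), 2 * (-q) ^ (k ^ 2) - 1) atTop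
      (𝓝 (thetaReal (-q))) := by
    have := (summable_norm_pow_natAbs_sq hq).of_norm.hasSum.nat_add_neg.tendsto_sum_nat
    have := ((tendsto_add_atTop_iff_nat 1).2 this).sub_const 1
    simpa [two_mul, thetaReal] using this
  have hE : Tendsto (fun n ↦ ∑ s ∈ Finset.range n, gaussTerm q n (s + 1)) atTop (𝓝 0) := by
    have hlim : Tendsto (fun n : ℕ ↦ 2 * ((n : ℝ) * q ^ n)) atTop (𝓝 0) := by
      simpa using (tendsto_self_mul_const_pow_of_lt_one h0.le h1).const_mul 2
    refine squeeze_zero_norm (fun n ↦ ?_) hlim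
    refine (norm_sum_le_of_le _ fun s hs ↦
      abs_gaussTerm_le h0 h1 (Finset.mem_range.1 hs)).trans_eq ?_
    simp
    ring
  have hR := hE.add (tendsto_gaussProd h0 h1)
  rw [zero_add] at hR
  refine tendsto_nhds_unique hL (hR.congr fun n ↦ ?_)
  rw [← sum_gaussTerm h0 h1, Finset.sum_range_succ']
  simp [gaussTerm, gaussProd]
  norm_num

lemma thetaReal_neg_pos {q : ℝ} (h0 : 0 < q) (h1 : q < 1) : 0 < thetaReal (-q) := by
  rw [thetaReal_neg_eq h0 h1]
  have := eulerReal_pos h0 h1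
  have := eulerReal_pos (pow_pos h0 2) (pow_lt_one₀ h0.le h1 two_ne_zero)
  positivity

lemma thetaReal_pos {q : ℝ} (h0 : 0 < q) (h1 : q < 1) : 0 < thetaReal q :=
  (thetaReal_neg_pos h0 h1).trans (thetaReal_neg_lt h0 h1)

lemma thetaReal_pow_four_sub_pos {q : ℝ} (h0 : 0 < q) (h1 : q < 1) :
    0 < thetaReal q ^ 4 - thetaReal (-q) ^ 4 :=
  sub_pos.2 (pow_lt_pow_left₀ (thetaReal_neg_lt h0 h1) (thetaReal_neg_pos h0 h1).le four_ne_zero)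

lemma thetaReal_eq {q : ℝ} (h0 : 0 < q) (h1 : q < 1) :
    thetaReal q = eulerReal (q ^ 2) ^ 5 / (eulerReal q ^ 2 * eulerReal (q ^ 4) ^ 2) := by
  have h2 : 0 < q ^ 2 := pow_pos h0 2
  have h3 : q ^ 2 < 1 := pow_lt_one₀ h0.le h1 two_ne_zero
  have h4 : (q ^ 2) ^ 2 = q ^ 4 := by ring
  have e1 := eulerReal_pos h0 h1
  have e2 := eulerReal_pos h2 h3
  have e4 := eulerReal_pos (pow_pos h0 4) (pow_lt_one₀ h0.le h1 four_ne_zero)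
  have h := thetaReal_mul_neg (q := q) (by rwa [abs_of_pos h0])
  rw [thetaReal_neg_eq h0 h1, thetaReal_neg_eq h2 h3, h4] at h
  field_simp at h ⊢
  linear_combination h

lemma tendsto_pow_two_pow {q : ℝ} (h0 : 0 < q) (h1 : q < 1) :
    Tendsto (fun n : ℕ ↦ q ^ 2 ^ n) atTop (𝓝[>] 0) := by
  refine tendsto_nhdsWithin_iff.2 ⟨?_, .of_forall fun n ↦ pow_pos h0 _⟩
  exact (tendsto_pow_atTop_nhds_zero_of_lt_one h0.le h1).comp
    (tendsto_pow_atTop_atTop_of_one_lt one_lt_two)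

/-- A function invariant under `q ↦ q²` is determined by its limit at `0`. -/
lemma eq_of_eq_comp_sq {f : ℝ → ℝ} {c : ℝ} (hf : ∀ q, 0 < q → q < 1 → f (q ^ 2) = f q)
    (hlim : Tendsto f (𝓝[>] 0) (𝓝 c)) {q : ℝ} (h0 : 0 < q) (h1 : q < 1) : f q = c := by
  have h (n : ℕ) : f (q ^ 2 ^ n) = f q := by
    induction n with
    | zero => simp
    | succ n ih =>
      rw [pow_succ, pow_mul, hf _ (pow_pos h0 _) (pow_lt_one₀ h0.le h1 (by positivity)), ih]
  refine tendsto_nhds_unique ?_ (hlim.comp (tendsto_pow_two_pow h0 h1))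
  simp [Function.comp_def, h]

/-- A positive function with `f (q²) = f(q)²` and limit `1` at `0` is identically `1`. -/
lemma eq_one_of_comp_sq_eq_sq {f : ℝ → ℝ} (hpos : ∀ q, 0 < q → q < 1 → 0 < f q)
    (hf : ∀ q, 0 < q → q < 1 → f (q ^ 2) = f q ^ 2)
    (hlim : Tendsto f (𝓝[>] 0) (𝓝 1)) {q : ℝ} (h0 : 0 < q) (h1 : q < 1) : f q = 1 := by
  have h (n : ℕ) : f (q ^ 2 ^ n) = f q ^ 2 ^ n := by
    induction n with
    | zero => simp
    | succ n ih =>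
      rw [pow_succ, pow_mul, hf _ (pow_pos h0 _) (pow_lt_one₀ h0.le h1 (by positivity)), ih, pow_mul]
  have ht := hlim.comp (tendsto_pow_two_pow h0 h1)
  simp only [Function.comp_def, h] at ht
  refine le_antisymm ?_ ?_
  · by_contra! hlt
    exact hlt.not_ge (ge_of_tendsto' ht fun n ↦ le_self_pow₀ hlt.le (by positivity))
  · by_contra! hlt
    exact hlt.not_ge (le_of_tendsto' ht fun n ↦
      pow_le_of_le_one (hpos q h0 h1).le hlt.le (by positivity))

lemma tendsto_thetaReal_zero : Tendsto thetaReal (𝓝[>] 0) (𝓝 1) := by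
  have h := (hasDerivAt_thetaReal (q := 0) (by simp)).continuousAt.tendsto
  rw [thetaReal_zero] at h
  exact h.mono_left nhdsWithin_le_nhds

lemma tendsto_neg_nhdsGT_zero : Tendsto (fun q : ℝ ↦ -q) (𝓝[>] 0) (𝓝 0) := by
  simpa using (continuous_neg.tendsto (0 : ℝ)).mono_left (nhdsWithin_le_nhds (s := Set.Ioi 0))

lemma tendsto_thetaReal_neg_zero : Tendsto (fun q ↦ thetaReal (-q)) (𝓝[>] 0) (𝓝 1) := by
  have h := (hasDerivAt_thetaReal (q := 0) (by simp)).continuousAt.tendsto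
  rw [thetaReal_zero] at h
  exact h.comp tendsto_neg_nhdsGT_zero

lemma hasDerivAt_thetaReal_neg {q : ℝ} (hq : |q| < 1) :
    HasDerivAt (fun x ↦ thetaReal (-x)) (-thetaRealDeriv (-q)) q := by
  have h := (hasDerivAt_thetaReal (q := -q) (by rwa [abs_neg])).comp q (hasDerivAt_neg q)
  simpa using! h

lemma tendsto_thetaReal_pow_four_sub_div :
    Tendsto (fun q ↦ (thetaReal q ^ 4 - thetaReal (-q) ^ 4) / q) (𝓝[>] 0) (𝓝 16) := by
  have h := ((hasDerivAt_thetaReal (q := 0) (by simp)).pow 4).sub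
    ((hasDerivAt_thetaReal_neg (q := 0) (by simp)).pow 4)
  have h2 := h.tendsto_slope_zero_right
  simp only [Pi.sub_apply, Pi.pow_apply, neg_zero, thetaReal_zero, thetaRealDeriv_zero] at h2
  norm_num at h2
  refine h2.congr fun q ↦ ?_
  ring

/-- The product formula `θ(q)⁴ - θ(-q)⁴ = 16 q ∏ (1 - q^{4m})⁸ / (1 - q^{2m})⁴`. -/
lemma thetaReal_pow_four_sub {q : ℝ} (h0 : 0 < q) (h1 : q < 1) :
    thetaReal q ^ 4 - thetaReal (-q) ^ 4 =
      16 * q * eulerReal (q ^ 4) ^ 8 / eulerReal (q ^ 2) ^ 4 := by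
  let f (q : ℝ) : ℝ := (thetaReal q ^ 4 - thetaReal (-q) ^ 4) / q *
    (eulerReal (q ^ 2) ^ 4 / (16 * eulerReal (q ^ 4) ^ 8))
  have e2 {x : ℝ} (h0 : 0 < x) (h1 : x < 1) : 0 < eulerReal (x ^ 2) :=
    eulerReal_pos (pow_pos h0 2) (pow_lt_one₀ h0.le h1 two_ne_zero)
  have e4 {x : ℝ} (h0 : 0 < x) (h1 : x < 1) : 0 < eulerReal (x ^ 4) :=
    eulerReal_pos (pow_pos h0 4) (pow_lt_one₀ h0.le h1 four_ne_zero)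
  have hlim : Tendsto f (𝓝[>] 0) (𝓝 1) := by
    have hE (k : ℕ) (hk : k ≠ 0) : Tendsto (fun q ↦ eulerReal (q ^ k)) (𝓝[>] 0) (𝓝 1) := by
      have h : Tendsto (fun q : ℝ ↦ q ^ k) (𝓝[>] 0) (𝓝 0) := by
        simpa [hk] using ((continuous_pow k).tendsto (0 : ℝ)).mono_left
          (nhdsWithin_le_nhds (s := Set.Ioi 0))
      have hc := continuousAt_eulerReal_zero.tendsto
      rw [eulerReal_zero] at hc
      exact hc.comp h
    have := tendsto_thetaReal_pow_four_sub_div.mul (((hE 2 two_ne_zero).pow 4).div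
      (((hE 4 four_ne_zero).pow 8).const_mul 16) (by norm_num))
    norm_num at this
    exact this
  have hf : f q = 1 := by
    refine eq_one_of_comp_sq_eq_sq (fun q h0 h1 ↦ ?_) (fun q h0 h1 ↦ ?_) hlim h0 h1
    · have := thetaReal_pow_four_sub_pos h0 h1
      have := e2 h0 h1
      have := e4 h0 h1
      positivity
    · have hq : |q| < 1 := by rwa [abs_of_pos h0]
      have hs := thetaReal_sq_add_sq hq
      have hm := thetaReal_mul_neg hq
      have hq2 : q ^ 2 < 1 := pow_lt_one₀ h0.le h1 two_ne_zero
      have ha := thetaReal_eq (pow_pos h0 2) hq2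
      have p2 := e2 h0 h1
      have p4 := e4 h0 h1
      have p8 := e4 (pow_pos h0 2) hq2
      have r4 : (q ^ 2) ^ 2 = q ^ 4 := by ring
      rw [r4] at ha
      simp only [f, r4]
      have hN : (thetaReal q ^ 4 - thetaReal (-q) ^ 4) ^ 2 =
          16 * (thetaReal (q ^ 2) ^ 4 - thetaReal (-q ^ 2) ^ 4) * thetaReal (q ^ 2) ^ 4 := by
        have h1 : thetaReal (q ^ 2) ^ 4 = ((thetaReal q ^ 2 + thetaReal (-q) ^ 2) / 2) ^ 2 := by
          rw [hs]; ring
        have h2 : thetaReal (-q ^ 2) ^ 4 = (thetaReal q * thetaReal (-q)) ^ 2 := by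
          rw [hm]; ring
        rw [h1, h2]
        ring
      rw [mul_pow, div_pow, hN, ha]
      field_simp
  have p2 := e2 h0 h1
  have p4 := e4 h0 h1
  simp only [f] at hf
  field_simp at hf ⊢
  linear_combination hf

lemma thetaReal_logDeriv_add {q : ℝ} (h0 : 0 < q) (h1 : q < 1) :
    q * (thetaRealDeriv q / thetaReal q + thetaRealDeriv (-q) / thetaReal (-q)) =
      (thetaReal q ^ 4 - thetaReal (-q) ^ 4) / 4 := by
  let f (q : ℝ) : ℝ := (thetaRealDeriv q / thetaReal q + thetaRealDeriv (-q) / thetaReal (-q)) /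
    ((thetaReal q ^ 4 - thetaReal (-q) ^ 4) / q)
  have hlim : Tendsto f (𝓝[>] 0) (𝓝 (1 / 4)) := by
    have hc := continuousAt_thetaRealDeriv_zero.tendsto
    rw [thetaRealDeriv_zero] at hc
    have := (((hc.mono_left nhdsWithin_le_nhds).div tendsto_thetaReal_zero one_ne_zero).add
      ((hc.comp tendsto_neg_nhdsGT_zero).div tendsto_thetaReal_neg_zero one_ne_zero)).div
      tendsto_thetaReal_pow_four_sub_div (by norm_num)
    norm_num at this ⊢
    exact this
  have hf : f q = 1 / 4 := by
    refine eq_of_eq_comp_sq (fun q h0 h1 ↦ ?_) hlim h0 h1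
    have hq : |q| < 1 := by rwa [abs_of_pos h0]
    have hq2 : |q ^ 2| < 1 := abs_sq_lt_one hq
    have h2 : 0 < q ^ 2 := pow_pos h0 2
    have h3 : q ^ 2 < 1 := pow_lt_one₀ h0.le h1 two_ne_zero
    have hA := hasDerivAt_thetaReal hq
    have hB := hasDerivAt_thetaReal_neg hq
    have hsq := hasDerivAt_pow 2 q
    have ha := HasDerivAt.comp (h := fun x : ℝ ↦ x ^ 2) q (hasDerivAt_thetaReal hq2) hsq
    have hb := HasDerivAt.comp (h := fun x : ℝ ↦ x ^ 2) q (hasDerivAt_thetaReal_neg hq2) hsq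
    have hev : ∀ᶠ x in 𝓝 q, |x| < 1 := (continuous_abs.tendsto q).eventually_lt_const hq
    have d1 := ((hA.pow 2).add (hB.pow 2)).unique (((ha.pow 2).const_mul 2).congr_of_eventuallyEq
      (hev.mono fun x hx ↦ thetaReal_sq_add_sq hx))
    have d2 := (hA.mul hB).unique ((hb.pow 2).congr_of_eventuallyEq
      (hev.mono fun x hx ↦ thetaReal_mul_neg hx))
    have hs := thetaReal_sq_add_sq hq
    have hm := thetaReal_mul_neg hq
    have pA := thetaReal_pos h0 h1
    have pB := thetaReal_neg_pos h0 h1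
    have pa := thetaReal_pos h2 h3
    have pb := thetaReal_neg_pos h2 h3
    have pN := thetaReal_pow_four_sub_pos h0 h1
    have pn := thetaReal_pow_four_sub_pos h2 h3
    simp only [Function.comp_apply] at d1 d2
    norm_num at d1 d2
    simp only [f]
    generalize thetaReal q = A at *
    generalize thetaReal (-q) = B at *
    generalize thetaReal (q ^ 2) = a at *
    generalize thetaReal (-q ^ 2) = b at *
    generalize thetaRealDeriv q = A' at *
    generalize thetaRealDeriv (-q) = B' at *
    generalize thetaRealDeriv (q ^ 2) = a' at *
    generalize thetaRealDeriv (-q ^ 2) = b' at *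
    have ea : a' / a = (A * A' - B * B') / (2 * q * (A ^ 2 + B ^ 2)) := by
      rw [hs]
      field_simp
      linear_combination -d1 / 2
    have eb : b' / b = (A * B' - A' * B) / (4 * q * (A * B)) := by
      rw [hm]
      field_simp
      linear_combination d2
    have en : a ^ 4 - b ^ 4 = ((A ^ 2 - B ^ 2) / 2) ^ 2 := by
      linear_combination -(A ^ 2 + B ^ 2 + 2 * a ^ 2) / 4 * hs + (A * B + b ^ 2) * hm
    have hN : A ^ 4 - B ^ 4 = (A ^ 2 - B ^ 2) * (A ^ 2 + B ^ 2) := by ring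
    have hd : A ^ 2 - B ^ 2 ≠ 0 := by
      intro h
      rw [hN, h, zero_mul] at pN
      exact lt_irrefl _ pN
    rw [ea, eb, en, hN]
    field_simp
    ring
  have pN := thetaReal_pow_four_sub_pos h0 h1
  simp only [f] at hf
  rw [div_eq_iff (div_pos pN h0).ne'] at hf
  rw [hf]
  field_simp

lemma hasDerivAt_thetaReal_neg_div {q : ℝ} (h0 : 0 < q) (h1 : q < 1) :
    HasDerivAt (fun x ↦ thetaReal (-x) / thetaReal x)
      (-(thetaReal (-q) / thetaReal q) * ((thetaReal q ^ 4 - thetaReal (-q) ^ 4) / (4 * q))) q := by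
  have hq : |q| < 1 := by rwa [abs_of_pos h0]
  have pA := thetaReal_pos h0 h1
  have pB := thetaReal_neg_pos h0 h1
  refine ((hasDerivAt_thetaReal_neg hq).div (hasDerivAt_thetaReal hq) pA.ne').congr_deriv ?_
  have h := thetaReal_logDeriv_add h0 h1
  field_simp at h ⊢
  linear_combination -h

lemma dedekindEta_mul_I (s : ℝ) (hs : 0 < s) :
    dedekindEta (Complex.I * s) =
      ((Real.exp (-(2 * Real.pi * s) / 24) * eulerReal (Real.exp (-(2 * Real.pi * s))) : ℝ) : ℂ) := by
  have hexp : 2 * (Real.pi : ℂ) * Complex.I * (Complex.I * s) = ((-(2 * Real.pi * s) : ℝ) : ℂ) := by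
    push_cast
    linear_combination (2 * (Real.pi : ℂ) * s) * Complex.I_sq
  have hq : |Real.exp (-(2 * Real.pi * s))| < 1 := by
    rw [Real.abs_exp, Real.exp_lt_one_iff]
    have := Real.pi_pos
    simp only [Left.neg_neg_iff]
    positivity
  rw [dedekindEta, hexp, Complex.ofReal_mul, ofReal_eulerReal hq]
  push_cast
  rfl

/-- Values of the eta function at `2kτ` for `τ = it`, in terms of `r = exp(-4πt/24)`. -/
lemma dedekindEta_nat_mul (t : ℝ) (ht : 0 < t) (k : ℕ) (hk : 0 < k) :
    dedekindEta ((2 * k : ℕ) * (Complex.I * t)) =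
      ((Real.exp (-(4 * Real.pi * t) / 24) ^ k *
        eulerReal (Real.exp (-(4 * Real.pi * t)) ^ k) : ℝ) : ℂ) := by
  have h : ((2 * k : ℕ) : ℂ) * (Complex.I * t) = Complex.I * ((2 * k * t : ℝ) : ℂ) := by
    push_cast
    ring
  have hk' : (0 : ℝ) < k := Nat.cast_pos.2 hk
  rw [h, dedekindEta_mul_I _ (by positivity), ← Real.exp_nat_mul, ← Real.exp_nat_mul]
  congr 4 <;> ring_nf

lemma exp_neg_four_pi_mul_lt_one {t : ℝ} (ht : 0 < t) : Real.exp (-(4 * Real.pi * t)) < 1 := by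
  rw [Real.exp_lt_one_iff]
  have := Real.pi_pos
  simp only [Left.neg_neg_iff]
  positivity

lemma xFun_I_mul (t : ℝ) (ht : 0 < t) :
    xFun (Complex.I * t) = ((thetaReal (-Real.exp (-(4 * Real.pi * t))) /
      thetaReal (Real.exp (-(4 * Real.pi * t))) : ℝ) : ℂ) := by
  have h2 := dedekindEta_nat_mul t ht 1 one_pos
  have h4 := dedekindEta_nat_mul t ht 2 two_pos
  have h8 := dedekindEta_nat_mul t ht 4 four_pos
  norm_num only [Nat.cast_ofNat] at h2 h4 h8
  have h0 := Real.exp_pos (-(4 * Real.pi * t))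
  have h1 := exp_neg_four_pi_mul_lt_one ht
  rw [xFun, h2, h4, h8, thetaReal_eq h0 h1, thetaReal_neg_eq h0 h1]
  have e1 := eulerReal_pos h0 h1
  have e2 := eulerReal_pos (pow_pos h0 2) (pow_lt_one₀ h0.le h1 two_ne_zero)
  have e4 := eulerReal_pos (pow_pos h0 4) (pow_lt_one₀ h0.le h1 four_ne_zero)
  have hr := Real.exp_pos (-(4 * Real.pi * t) / 24)
  generalize Real.exp (-(4 * Real.pi * t) / 24) = r at *
  norm_cast
  field_simp

/-- On the positive imaginary axis `τ = it`, `t > 0`, the differential identity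
`(1/(2πi)) · x(τ)x′(τ)/(2√(1 - x(τ)⁴)) = -η(2τ)⁴η(8τ)⁴/η(4τ)⁴` holds, where the
square root is the positive real one (well defined as `0 < x(it) < 1`). -/
theorem xFun_differential_identity (t : ℝ) (ht : 0 < t) (d : ℂ)
    (hd : HasDerivAt xFun d (Complex.I * t)) :
    (1 / (2 * Real.pi * Complex.I)) * (xFun (Complex.I * t) * d) /
        (2 * (Real.sqrt (1 - ((xFun (Complex.I * t)).re) ^ 4) : ℂ))
      = -(dedekindEta (2 * (Complex.I * t)) ^ 4 * dedekindEta (8 * (Complex.I * t)) ^ 4 /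
          dedekindEta (4 * (Complex.I * t)) ^ 4) := by
  have h0 := Real.exp_pos (-(4 * Real.pi * t))
  have h1 := exp_neg_four_pi_mul_lt_one ht
  have hderiv : d * Complex.I = ((-(thetaReal (-Real.exp (-(4 * Real.pi * t))) /
      thetaReal (Real.exp (-(4 * Real.pi * t)))) *
      ((thetaReal (Real.exp (-(4 * Real.pi * t))) ^ 4 -
        thetaReal (-Real.exp (-(4 * Real.pi * t))) ^ 4) / (4 * Real.exp (-(4 * Real.pi * t)))) *
      (Real.exp (-(4 * Real.pi * t)) * -(4 * Real.pi)) : ℝ) : ℂ) := by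
    have hline : HasDerivAt (fun z : ℂ ↦ Complex.I * z) Complex.I (t : ℂ) := by
      simpa using (hasDerivAt_id (t : ℂ)).const_mul Complex.I
    have hL := (HasDerivAt.comp (t : ℂ) hd hline).comp_ofReal
    have hexp : HasDerivAt (fun u : ℝ ↦ Real.exp (-(4 * Real.pi * u)))
        (Real.exp (-(4 * Real.pi * t)) * -(4 * Real.pi)) t := by
      simpa using ((hasDerivAt_id t).const_mul (4 * Real.pi)).neg.exp
    have hR := (HasDerivAt.comp t (hasDerivAt_thetaReal_neg_div h0 h1) hexp).ofReal_comp
    refine hL.unique (hR.congr_of_eventuallyEq ?_)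
    filter_upwards [lt_mem_nhds ht] with u hu
    exact xFun_I_mul u hu
  have hd' : d = -Complex.I * (d * Complex.I) := by
    linear_combination d * Complex.I_sq
  have h2 := dedekindEta_nat_mul t ht 1 one_pos
  have h4 := dedekindEta_nat_mul t ht 2 two_pos
  have h8 := dedekindEta_nat_mul t ht 4 four_pos
  norm_num only [Nat.cast_ofNat, pow_one] at h2 h4 h8
  have e1 := eulerReal_pos h0 h1
  have e2 := eulerReal_pos (pow_pos h0 2) (pow_lt_one₀ h0.le h1 two_ne_zero)
  have e4 := eulerReal_pos (pow_pos h0 4) (pow_lt_one₀ h0.le h1 four_ne_zero)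
  have hr := Real.exp_pos (-(4 * Real.pi * t) / 24)
  have hq : Real.exp (-(4 * Real.pi * t)) = Real.exp (-(4 * Real.pi * t) / 24) ^ 24 := by
    rw [← Real.exp_nat_mul]
    congr 1
    push_cast
    ring
  have hA := thetaReal_eq h0 h1
  have hB := thetaReal_neg_eq h0 h1
  have hN := thetaReal_pow_four_sub h0 h1
  have pA := thetaReal_pos h0 h1
  rw [hd', hderiv, xFun_I_mul t ht, h2, h4, h8, Complex.ofReal_re]
  generalize Real.exp (-(4 * Real.pi * t) / 24) = r at *
  generalize Real.exp (-(4 * Real.pi * t)) = q at *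
  have hsqrt : Real.sqrt (1 - (thetaReal (-q) / thetaReal q) ^ 4) =
      4 * r ^ 12 * eulerReal (q ^ 4) ^ 4 / (eulerReal (q ^ 2) ^ 2 * thetaReal q ^ 2) := by
    have h : 1 - (thetaReal (-q) / thetaReal q) ^ 4 =
        (4 * r ^ 12 * eulerReal (q ^ 4) ^ 4 / (eulerReal (q ^ 2) ^ 2 * thetaReal q ^ 2)) ^ 2 := by
      have : 1 - (thetaReal (-q) / thetaReal q) ^ 4 =
          (thetaReal q ^ 4 - thetaReal (-q) ^ 4) / thetaReal q ^ 4 := by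
        field_simp
      rw [this, hN, show 16 * q = 16 * r ^ 24 by rw [← hq]]
      field_simp
      norm_num
    rw [h, Real.sqrt_sq (by positivity)]
  rw [hsqrt, hN, hA, hB]
  have hC (x y z : ℝ) : 1 / (2 * Real.pi * Complex.I) * ((x : ℂ) * (-Complex.I * (y : ℂ))) /
      (2 * (z : ℂ)) = ((-(x * y / (4 * Real.pi * z)) : ℝ) : ℂ) := by
    push_cast
    field_simp
    ring
  rw [hC, ← Complex.ofReal_pow]
  norm_cast
  have := Real.pi_pos
  generalize eulerReal q = a at *
  generalize eulerReal (q ^ 2) = b at *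
  generalize eulerReal (q ^ 4) = c at *
  rw [hq]
  field_simp
  ring
end

section
/- Define x(τ) := η(2τ)⁴η(8τ)²/η(4τ)⁶. For every τ in the complex upper half-plane one has the identity (√2·η(8τ)·η(32τ)²/η(16τ)³)² = (1 − x(τ))/(1 + x(τ)); equivalently, 2·η(8τ)²η(32τ)⁴/η(16τ)⁶ = (1 − x(τ))/(1 + x(τ)). -/
open Filter Topology Finset

/-- The Euler product `∏_{m ≥ 1} (1 - x^m)`. -/
noncomputable def eulerProd (x : ℂ) : ℂ := ∏' m : ℕ, (1 - x ^ (m + 1))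

/-- The finite `q`-Pochhammer product `∏_{1 ≤ m ≤ n} (1 - p^m)`. -/
noncomputable def finEulerProd (p : ℂ) (n : ℕ) : ℂ := ∏ k ∈ range n, (1 - p ^ (k + 1))

/-- The inverse of `finEulerProd p m`, extended by zero to negative integers `m`. -/
noncomputable def invFinEulerProd (p : ℂ) (m : ℤ) : ℂ :=
  if 0 ≤ m then (finEulerProd p m.toNat)⁻¹ else 0

/-- The theta series `∑_j z^j Q^{j²}`. -/
noncomputable def thetaSeries (z Q : ℂ) : ℂ := ∑' j : ℤ, z ^ j * Q ^ (j ^ 2)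

lemma one_sub_pow_succ_ne_zero {p : ℂ} (hp : ‖p‖ < 1) (k : ℕ) : 1 - p ^ (k + 1) ≠ 0 := by
  intro h
  have h1 : ‖p ^ (k + 1)‖ < 1 := by
    rw [norm_pow]; exact pow_lt_one₀ (norm_nonneg _) hp (by simp)
  rw [← sub_eq_zero.mp h] at h1
  simp at h1

lemma finEulerProd_ne_zero {p : ℂ} (hp : ‖p‖ < 1) (n : ℕ) : finEulerProd p n ≠ 0 :=
  prod_ne_zero_iff.mpr fun k _ ↦ one_sub_pow_succ_ne_zero hp k

lemma eulerProd_ne_zero {x : ℂ} (hx : ‖x‖ < 1) : eulerProd x ≠ 0 := by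
  have hs : Summable fun n : ℕ ↦ ‖-x ^ (n + 1)‖ := by
    simpa using (summable_nat_add_iff 1).mpr (summable_geometric_of_lt_one (norm_nonneg _) hx)
  have := tprod_one_add_ne_zero_of_summable (f := fun n : ℕ ↦ -x ^ (n + 1))
    (fun i ↦ by simpa [← sub_eq_add_neg] using one_sub_pow_succ_ne_zero hx i) hs
  simpa [eulerProd, sub_eq_add_neg] using this

lemma tendsto_finEulerProd {p : ℂ} (hp : ‖p‖ < 1) :
    Tendsto (finEulerProd p) atTop (𝓝 (eulerProd p)) :=
  (ModularForm.multipliable_one_sub_pow hp).tendsto_prod_tprod_nat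

lemma invFinEulerProd_eq {p : ℂ} (hp : ‖p‖ < 1) (m : ℤ) :
    invFinEulerProd p m = (1 - p ^ (m + 1)) * invFinEulerProd p (m + 1) := by
  rcases lt_trichotomy m (-1) with h | rfl | h
  · simp [invFinEulerProd, show ¬ 0 ≤ m by omega, show ¬ 0 ≤ m + 1 by omega]
  · simp [invFinEulerProd]
  · lift m to ℕ using by omega
    have h1 : ((m : ℤ) + 1).toNat = m + 1 := by omega
    have h2 := one_sub_pow_succ_ne_zero hp m
    have h3 := finEulerProd_ne_zero hp m
    rw [invFinEulerProd, invFinEulerProd, if_pos (by omega), if_pos (by omega), h1,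
      finEulerProd, finEulerProd, prod_range_succ, ← finEulerProd, Int.toNat_natCast,
      ← finEulerProd]
    have h4 : p ^ ((m : ℤ) + 1) = p ^ (m + 1) := by exact_mod_cast rfl
    rw [h4]
    field_simp

lemma tendsto_invFinEulerProd {p : ℂ} (hp : ‖p‖ < 1) :
    Tendsto (invFinEulerProd p) atTop (𝓝 (eulerProd p)⁻¹) := by
  have ht : Tendsto Int.toNat atTop atTop := tendsto_atTop.mpr fun b ↦ by
    filter_upwards [eventually_ge_atTop (b : ℤ)] with m hm using by omega
  have h := ((tendsto_finEulerProd hp).comp ht).inv₀ (eulerProd_ne_zero hp)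
  refine h.congr' ?_
  filter_upwards [eventually_ge_atTop 0] with m hm
  simp [invFinEulerProd, hm]

lemma exists_norm_finEulerProd_le {p : ℂ} (hp : ‖p‖ < 1) :
    ∃ C, ∀ n, ‖finEulerProd p n‖ ≤ C := by
  obtain ⟨C, hC⟩ := (Metric.isBounded_range_of_tendsto _ (tendsto_finEulerProd hp)).exists_norm_le
  exact ⟨C, fun n ↦ hC _ ⟨n, rfl⟩⟩

lemma exists_norm_invFinEulerProd_le {p : ℂ} (hp : ‖p‖ < 1) :
    ∃ C, ∀ m, ‖invFinEulerProd p m‖ ≤ C := by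
  obtain ⟨C, hC⟩ := (Metric.isBounded_range_of_tendsto _
    ((tendsto_finEulerProd hp).inv₀ (eulerProd_ne_zero hp))).exists_norm_le
  refine ⟨C, fun m ↦ ?_⟩
  have h := fun n ↦ hC _ ⟨n, rfl⟩
  unfold invFinEulerProd
  split_ifs
  · exact h _
  · simpa using (norm_nonneg _).trans (h 0)

/-- The `p`-binomial coefficient `[2n choose n+j]`, zero for `|j| > n`. -/
noncomputable def centralQBinom (p : ℂ) (n : ℕ) (j : ℤ) : ℂ :=
  finEulerProd p (2 * n) * invFinEulerProd p (n + j) * invFinEulerProd p (n - j)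

lemma centralQBinom_succ {p : ℂ} (hp0 : p ≠ 0) (hp : ‖p‖ < 1) (n : ℕ) (j : ℤ) :
    centralQBinom p (n + 1) j = (1 + p ^ (2 * n + 1)) * centralQBinom p n j
      + p ^ (n + 1 - j) * centralQBinom p n (j - 1)
      + p ^ (n + 1 + j) * centralQBinom p n (j + 1) := by
  have e1 := invFinEulerProd_eq hp (n + j)
  have e2 := invFinEulerProd_eq hp (n - j)
  have e3 := invFinEulerProd_eq hp (n + (j - 1))
  have e4 := invFinEulerProd_eq hp (n - (j + 1))
  have f1 : (n : ℤ) + (j - 1) + 1 = n + j := by ring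
  have f2 : (n : ℤ) - (j + 1) + 1 = n - j := by ring
  have f3 : (n : ℤ) - (j - 1) = n - j + 1 := by ring
  have f4 : (n : ℤ) + (j + 1) = n + j + 1 := by ring
  have f5 : ((n + 1 : ℕ) : ℤ) + j = n + j + 1 := by push_cast; ring
  have f6 : ((n + 1 : ℕ) : ℤ) - j = n - j + 1 := by push_cast; ring
  have f7 : (n : ℤ) + 1 - j = n - j + 1 := by ring
  have f8 : (n : ℤ) + 1 + j = n + j + 1 := by ring
  rw [f1] at e3
  rw [f2] at e4
  unfold centralQBinom
  rw [f3, f4, f5, f6, f7, f8, e3, e4, e1, e2, show 2 * (n + 1) = 2 * n + 1 + 1 by ring]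
  have hS : finEulerProd p (2 * n + 1 + 1)
      = finEulerProd p (2 * n) * (1 - p ^ (2 * n + 1)) * (1 - p ^ (2 * n + 1 + 1)) := by
    simp [finEulerProd, prod_range_succ]
  have hAB : p ^ (2 * n + 1) = p ^ ((n : ℤ) + j) * p ^ ((n : ℤ) - j) * p := by
    rw [← zpow_add₀ hp0, show (n : ℤ) + j + (n - j) = (2 * n : ℕ) by push_cast; ring,
      zpow_natCast, pow_succ]
  rw [hS, pow_succ p (2 * n + 1), hAB, zpow_add_one₀ hp0, zpow_add_one₀ hp0]
  ring

lemma hasSum_centralQBinom {Q z : ℂ} (hQ0 : Q ≠ 0) (hQ : ‖Q‖ < 1) (hz : z ≠ 0) (n : ℕ) :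
    HasSum (fun j : ℤ ↦ centralQBinom (Q ^ 2) n j * (z ^ j * Q ^ (j ^ 2)))
      (∏ k ∈ range n, ((1 + z * Q ^ (2 * k + 1)) * (1 + z⁻¹ * Q ^ (2 * k + 1)))) := by
  have hp0 : Q ^ 2 ≠ 0 := pow_ne_zero _ hQ0
  have hp : ‖Q ^ 2‖ < 1 := by
    rw [norm_pow]; exact pow_lt_one₀ (norm_nonneg _) hQ (by simp)
  induction n with
  | zero =>
    convert hasSum_single (0 : ℤ) ?_ using 1
    · simp [centralQBinom, invFinEulerProd, finEulerProd]
    · intro j hj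
      rcases lt_or_gt_of_ne hj with h | h
      · simp [centralQBinom, invFinEulerProd, show ¬ 0 ≤ j by omega]
      · simp [centralQBinom, invFinEulerProd, show ¬ j ≤ 0 by omega]
  | succ n ih =>
    rw [prod_range_succ]
    set P := ∏ k ∈ range n, ((1 + z * Q ^ (2 * k + 1)) * (1 + z⁻¹ * Q ^ (2 * k + 1)))
    have h1 := ((Equiv.subRight (1 : ℤ)).hasSum_iff.mpr ih).mul_left (z * Q ^ (2 * n + 1))
    have h2 := ((Equiv.addRight (1 : ℤ)).hasSum_iff.mpr ih).mul_left (z⁻¹ * Q ^ (2 * n + 1))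
    have h0 := ih.mul_left (1 + (Q ^ 2) ^ (2 * n + 1))
    have hP : (1 + (Q ^ 2) ^ (2 * n + 1)) * P + z * Q ^ (2 * n + 1) * P
        + z⁻¹ * Q ^ (2 * n + 1) * P
        = P * ((1 + z * Q ^ (2 * n + 1)) * (1 + z⁻¹ * Q ^ (2 * n + 1))) := by
      rw [← pow_mul, mul_comm 2, pow_mul]
      linear_combination -P * (Q ^ (2 * n + 1)) ^ 2 * mul_inv_cancel₀ hz
    have key := (h0.add h1).add h2
    rw [hP] at key
    refine (congrArg (HasSum · _) (funext fun j ↦ ?_)).mpr key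
    simp only [Function.comp, Equiv.subRight_apply, Equiv.coe_addRight]
    rw [centralQBinom_succ hp0 hp]
    have g1 : z * Q ^ (2 * n + 1) * (z ^ (j - 1) * Q ^ ((j - 1) ^ 2))
        = (Q ^ 2) ^ ((n : ℤ) + 1 - j) * (z ^ j * Q ^ (j ^ 2)) := by
      have : Q ^ (2 * n + 1) * Q ^ ((j - 1) ^ 2)
          = (Q ^ 2) ^ ((n : ℤ) + 1 - j) * Q ^ (j ^ 2) := by
        rw [← zpow_natCast Q 2, ← zpow_natCast Q (2 * n + 1), ← zpow_mul, ← zpow_add₀ hQ0,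
          ← zpow_add₀ hQ0]
        congr 1; push_cast; ring
      rw [zpow_sub_one₀ hz]
      linear_combination (z * (z ^ j * z⁻¹)) * this +
        (Q ^ 2) ^ ((n : ℤ) + 1 - j) * Q ^ (j ^ 2) * z ^ j * mul_inv_cancel₀ hz
    have g2 : z⁻¹ * Q ^ (2 * n + 1) * (z ^ (j + 1) * Q ^ ((j + 1) ^ 2))
        = (Q ^ 2) ^ ((n : ℤ) + 1 + j) * (z ^ j * Q ^ (j ^ 2)) := by
      have : Q ^ (2 * n + 1) * Q ^ ((j + 1) ^ 2)
          = (Q ^ 2) ^ ((n : ℤ) + 1 + j) * Q ^ (j ^ 2) := by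
        rw [← zpow_natCast Q 2, ← zpow_natCast Q (2 * n + 1), ← zpow_mul, ← zpow_add₀ hQ0,
          ← zpow_add₀ hQ0]
        congr 1; push_cast; ring
      rw [zpow_add_one₀ hz]
      linear_combination (z⁻¹ * (z ^ j * z)) * this +
        (Q ^ 2) ^ ((n : ℤ) + 1 + j) * Q ^ (j ^ 2) * z ^ j * mul_inv_cancel₀ hz
    linear_combination -centralQBinom (Q ^ 2) n (j - 1) * g1
      - centralQBinom (Q ^ 2) n (j + 1) * g2

lemma summable_thetaSeries {Q z : ℂ} (hQ0 : Q ≠ 0) (hQ : ‖Q‖ < 1) (hz : z ≠ 0) :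
    Summable fun j : ℤ ↦ z ^ j * Q ^ (j ^ 2) := by
  have hpi : (Real.pi : ℂ) ≠ 0 := by exact_mod_cast Real.pi_ne_zero
  set T : ℂ := -Complex.I * Complex.log Q / Real.pi with hT
  set w : ℂ := -Complex.I * Complex.log z / (2 * Real.pi) with hw
  have hTim : 0 < T.im := by
    have : T.im = -Real.log ‖Q‖ / Real.pi := by
      rw [hT, Complex.div_ofReal_im]; simp [Complex.log_re]
    rw [this]
    exact div_pos (neg_pos.mpr (Real.log_neg (norm_pos_iff.mpr hQ0) hQ)) Real.pi_pos
  refine ((summable_jacobiTheta₂_term_iff w T).mpr hTim).congr fun j ↦ ?_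
  have h1 : 2 * Real.pi * Complex.I * j * w = j * Complex.log z := by
    rw [hw]; field_simp; linear_combination -j * Complex.log z * Complex.I_sq
  have h2 : Real.pi * Complex.I * j ^ 2 * T = ((j ^ 2 : ℤ) : ℂ) * Complex.log Q := by
    rw [hT]; push_cast; field_simp; linear_combination -j ^ 2 * Complex.log Q * Complex.I_sq
  rw [jacobiTheta₂_term, h1, h2, Complex.exp_add, Complex.exp_int_mul, Complex.exp_int_mul,
    Complex.exp_log hz, Complex.exp_log hQ0]

lemma summable_norm_mul_pow_odd {Q : ℂ} (hQ : ‖Q‖ < 1) (c : ℂ) :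
    Summable fun k : ℕ ↦ ‖c * Q ^ (2 * k + 1)‖ := by
  have h : Function.Injective fun k : ℕ ↦ 2 * k + 1 := fun a b h ↦ by simpa using h
  simpa using ((summable_geometric_of_lt_one (norm_nonneg _) hQ).comp_injective h).mul_left ‖c‖

lemma multipliable_one_add_mul_pow_odd {Q : ℂ} (hQ : ‖Q‖ < 1) (c : ℂ) :
    Multipliable fun k : ℕ ↦ 1 + c * Q ^ (2 * k + 1) :=
  multipliable_one_add_of_summable (summable_norm_mul_pow_odd hQ c)

/-- The **Jacobi triple product identity**. -/
theorem thetaSeries_eq_tripleProduct {Q z : ℂ} (hQ0 : Q ≠ 0) (hQ : ‖Q‖ < 1) (hz : z ≠ 0) :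
    thetaSeries z Q = eulerProd (Q ^ 2) * (∏' k : ℕ, (1 + z * Q ^ (2 * k + 1))) *
      ∏' k : ℕ, (1 + z⁻¹ * Q ^ (2 * k + 1)) := by
  have hp : ‖Q ^ 2‖ < 1 := by
    rw [norm_pow]; exact pow_lt_one₀ (norm_nonneg _) hQ (by simp)
  have hE := eulerProd_ne_zero hp
  obtain ⟨C, hC⟩ := exists_norm_finEulerProd_le hp
  obtain ⟨D, hD⟩ := exists_norm_invFinEulerProd_le hp
  have hC0 := (norm_nonneg _).trans (hC 0)
  have hD0 := (norm_nonneg _).trans (hD 0)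
  have hlim : Tendsto (fun n : ℕ ↦ ∑' j : ℤ, centralQBinom (Q ^ 2) n j * (z ^ j * Q ^ (j ^ 2)))
      atTop (𝓝 (∑' j : ℤ, (eulerProd (Q ^ 2))⁻¹ * (z ^ j * Q ^ (j ^ 2)))) := by
    refine tendsto_tsum_of_dominated_convergence
      (bound := fun j : ℤ ↦ C * D * D * ‖z ^ j * Q ^ (j ^ 2)‖)
      ((summable_thetaSeries hQ0 hQ hz).norm.mul_left _) (fun j ↦ ?_) (.of_forall fun n j ↦ ?_)
    · refine Tendsto.mul_const _ ?_
      have t1 := (tendsto_finEulerProd hp).comp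
        (tendsto_id.const_mul_atTop' (show 0 < 2 by norm_num))
      have t2 := (tendsto_invFinEulerProd hp).comp
        (tendsto_atTop_add_const_right _ j (tendsto_natCast_atTop_atTop (R := ℤ)))
      have t3 := (tendsto_invFinEulerProd hp).comp
        (tendsto_atTop_add_const_right _ (-j) (tendsto_natCast_atTop_atTop (R := ℤ)))
      have t := (t1.mul t2).mul t3
      rw [mul_inv_cancel₀ hE, one_mul] at t
      exact t
    · rw [norm_mul, centralQBinom, norm_mul, norm_mul]
      gcongr
      exacts [hC _, hD _, hD _]
  simp_rw [(hasSum_centralQBinom hQ0 hQ hz _).tsum_eq, prod_mul_distrib] at hlim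
  have hprod := (multipliable_one_add_mul_pow_odd hQ z).tendsto_prod_tprod_nat.mul
    (multipliable_one_add_mul_pow_odd hQ z⁻¹).tendsto_prod_tprod_nat
  have := tendsto_nhds_unique hlim hprod
  rw [tsum_mul_left, ← thetaSeries] at this
  rw [mul_assoc, ← this, mul_inv_cancel_left₀ hE]

lemma norm_pow_lt_one {Q : ℂ} (hQ : ‖Q‖ < 1) {n : ℕ} (hn : n ≠ 0) : ‖Q ^ n‖ < 1 := by
  rw [norm_pow]; exact pow_lt_one₀ (norm_nonneg _) hQ hn

lemma tprod_one_sub_pow_odd_mul {Q : ℂ} (hQ : ‖Q‖ < 1) :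
    (∏' k : ℕ, (1 - Q ^ (2 * k + 1))) * eulerProd (Q ^ 2) = eulerProd Q := by
  have h1 : Multipliable fun k : ℕ ↦ 1 - Q ^ (2 * k + 1) := by
    simpa [sub_eq_add_neg] using multipliable_one_add_mul_pow_odd hQ (-1)
  have h2 := ModularForm.multipliable_one_sub_pow (norm_pow_lt_one hQ two_ne_zero)
  simp_rw [← pow_mul] at h2
  rw [eulerProd, eulerProd, ← tprod_even_mul_odd (f := fun m : ℕ ↦ 1 - Q ^ (m + 1)) h1 h2]
  simp_rw [← pow_mul]
  rfl

lemma multipliable_one_add_pow_succ {x : ℂ} (hx : ‖x‖ < 1) :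
    Multipliable fun k : ℕ ↦ 1 + x ^ (k + 1) := by
  apply multipliable_one_add_of_summable
  simpa using (summable_nat_add_iff 1).mpr (summable_geometric_of_lt_one (norm_nonneg _) hx)

lemma tprod_one_add_pow_succ_mul {x : ℂ} (hx : ‖x‖ < 1) :
    (∏' k : ℕ, (1 + x ^ (k + 1))) * eulerProd x = eulerProd (x ^ 2) := by
  rw [eulerProd, eulerProd, ← (multipliable_one_add_pow_succ hx).tprod_mul
    (ModularForm.multipliable_one_sub_pow hx)]
  exact tprod_congr fun k ↦ by ring

lemma tprod_one_add_pow_odd_mul {Q : ℂ} (hQ : ‖Q‖ < 1) :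
    (∏' k : ℕ, (1 + Q ^ (2 * k + 1))) * (eulerProd Q * eulerProd (Q ^ 4))
      = eulerProd (Q ^ 2) ^ 2 := by
  have h1 : Multipliable fun k : ℕ ↦ 1 + Q ^ (2 * k + 1) := by
    simpa using multipliable_one_add_mul_pow_odd hQ 1
  have hQ2 := norm_pow_lt_one hQ two_ne_zero
  have h2 := multipliable_one_add_pow_succ hQ2
  have h3 := tprod_one_add_pow_succ_mul hQ2
  simp_rw [← pow_mul] at h2 h3
  have h4 := tprod_even_mul_odd (f := fun m : ℕ ↦ 1 + Q ^ (m + 1)) h1 h2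
  have h5 := tprod_one_add_pow_succ_mul hQ
  change (∏' k : ℕ, (1 + Q ^ (2 * k + 1))) * (∏' k : ℕ, (1 + Q ^ (2 * (k + 1)))) = _ at h4
  norm_num at h3
  rw [← h4] at h5
  linear_combination eulerProd (Q ^ 2) * h5 -
    (∏' k : ℕ, (1 + Q ^ (2 * k + 1))) * eulerProd Q * h3

lemma thetaSeries_one {Q : ℂ} (hQ0 : Q ≠ 0) (hQ : ‖Q‖ < 1) :
    thetaSeries 1 Q = eulerProd (Q ^ 2) ^ 5 / (eulerProd Q ^ 2 * eulerProd (Q ^ 4) ^ 2) := by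
  have h := tprod_one_add_pow_odd_mul hQ
  have h1 := eulerProd_ne_zero hQ
  have h4 := eulerProd_ne_zero (norm_pow_lt_one hQ four_ne_zero)
  rw [thetaSeries_eq_tripleProduct hQ0 hQ one_ne_zero, eq_div_iff (by positivity)]
  simp only [inv_one, one_mul]
  linear_combination eulerProd (Q ^ 2) * (eulerProd (Q ^ 2) ^ 2 +
    (∏' k : ℕ, (1 + Q ^ (2 * k + 1))) * (eulerProd Q * eulerProd (Q ^ 4))) * h

lemma thetaSeries_neg_one {Q : ℂ} (hQ0 : Q ≠ 0) (hQ : ‖Q‖ < 1) :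
    thetaSeries (-1) Q = eulerProd Q ^ 2 / eulerProd (Q ^ 2) := by
  have h2 := eulerProd_ne_zero (norm_pow_lt_one hQ two_ne_zero)
  rw [thetaSeries_eq_tripleProduct hQ0 hQ (by simp), ← tprod_one_sub_pow_odd_mul hQ,
    eq_div_iff h2]
  simp only [inv_neg, inv_one, neg_mul, one_mul, ← sub_eq_add_neg]
  ring

lemma thetaSeries_self {Q : ℂ} (hQ0 : Q ≠ 0) (hQ : ‖Q‖ < 1) :
    thetaSeries Q Q = 2 * eulerProd (Q ^ 4) ^ 2 / eulerProd (Q ^ 2) := by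
  have hQ2 := norm_pow_lt_one hQ two_ne_zero
  have h2 := eulerProd_ne_zero hQ2
  have h3 := tprod_one_add_pow_succ_mul hQ2
  have m := multipliable_one_add_pow_succ hQ2
  have e1 : ∏' k : ℕ, (1 + Q * Q ^ (2 * k + 1)) = ∏' k : ℕ, (1 + (Q ^ 2) ^ (k + 1)) :=
    tprod_congr fun k ↦ by ring
  have e2 : ∏' k : ℕ, (1 + Q⁻¹ * Q ^ (2 * k + 1)) = 2 * ∏' k : ℕ, (1 + (Q ^ 2) ^ (k + 1)) := by
    have e : ∀ k : ℕ, 1 + Q⁻¹ * Q ^ (2 * k + 1) = 1 + (Q ^ 2) ^ k := fun k ↦ by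
      rw [pow_succ, pow_mul]; field_simp
    simp_rw [e]
    rw [tprod_eq_zero_mul' (f := fun k : ℕ ↦ 1 + (Q ^ 2) ^ k) m]
    norm_num
  rw [thetaSeries_eq_tripleProduct hQ0 hQ hQ0, e1, e2, eq_div_iff h2,
    show Q ^ 4 = (Q ^ 2) ^ 2 by ring, ← h3]
  ring

lemma tsum_int_even_add_odd {f : ℤ → ℂ} (hf : Summable f) :
    ∑' j, f j = ∑' j, f (2 * j) + ∑' j, f (2 * j + 1) := by
  have he : Function.Injective fun j : ℤ ↦ 2 * j := fun a b h ↦ by simpa using h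
  have ho : Function.Injective fun j : ℤ ↦ 2 * j + 1 := fun a b h ↦ by simpa using h
  refine (((he.hasSum_range_iff.mpr (hf.comp_injective he).hasSum)).add_isCompl ?_
    (ho.hasSum_range_iff.mpr (hf.comp_injective ho).hasSum)).tsum_eq
  simpa [Function.comp_def] using Int.isCompl_even_odd

lemma thetaSeries_sub_add {Q : ℂ} (hQ0 : Q ≠ 0) (hQ : ‖Q‖ < 1) :
    thetaSeries 1 Q = thetaSeries 1 (Q ^ 4) + Q * thetaSeries (Q ^ 4) (Q ^ 4) ∧
    thetaSeries (-1) Q = thetaSeries 1 (Q ^ 4) - Q * thetaSeries (Q ^ 4) (Q ^ 4) := by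
  have a : ∀ j : ℤ, Q ^ ((2 * j) ^ 2) = (Q ^ 4) ^ (j ^ 2) := fun j ↦ by
    rw [← zpow_natCast Q 4, ← zpow_mul]; congr 1; push_cast; ring
  have b : ∀ j : ℤ, Q ^ ((2 * j + 1) ^ 2) = Q * ((Q ^ 4) ^ j * (Q ^ 4) ^ (j ^ 2)) := fun j ↦ by
    rw [← zpow_natCast Q 4, ← zpow_mul, ← zpow_mul, ← zpow_add₀ hQ0, ← zpow_one_add₀ hQ0]
    congr 1; push_cast; ring
  have c : ∀ j : ℤ, (-1 : ℂ) ^ (2 * j) = 1 := fun j ↦ by simp [zpow_mul]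
  have d : ∀ j : ℤ, (-1 : ℂ) ^ (2 * j + 1) = -1 := fun j ↦ by
    rw [zpow_add_one₀ (by simp), c]; simp
  constructor
  · rw [thetaSeries, tsum_int_even_add_odd (summable_thetaSeries hQ0 hQ one_ne_zero)]
    simp [a, b, tsum_mul_left, thetaSeries]
  · rw [thetaSeries, tsum_int_even_add_odd (summable_thetaSeries hQ0 hQ (by simp))]
    simp [a, b, c, d, tsum_mul_left, tsum_neg, thetaSeries, sub_eq_add_neg]

lemma dedekindEta_natCast_mul (n : ℕ) (τ : ℂ) :
    dedekindEta (n * τ) = Complex.exp (2 * Real.pi * Complex.I * τ / 24) ^ n *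
      eulerProd (Complex.exp (2 * Real.pi * Complex.I * τ) ^ n) := by
  rw [dedekindEta, eulerProd, ← Complex.exp_nat_mul, ← Complex.exp_nat_mul]
  congr 3
  · ring
  · ext m; congr 3; ring

/-- On the upper half-plane, `(√2·η(8τ)η(32τ)²/η(16τ)³)² = (1-x(τ))/(1+x(τ))`;
equivalently `2·η(8τ)²η(32τ)⁴/η(16τ)⁶ = (1-x(τ))/(1+x(τ))`. -/
theorem eta_quotient_sq_eq_one_sub_x_div_one_add_x (τ : ℂ) (hτ : 0 < τ.im) :
    (((Real.sqrt 2 : ℂ)) * dedekindEta (8 * τ) * dedekindEta (32 * τ) ^ 2 /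
        dedekindEta (16 * τ) ^ 3) ^ 2
      = (1 - xFun τ) / (1 + xFun τ) ∧
    2 * dedekindEta (8 * τ) ^ 2 * dedekindEta (32 * τ) ^ 4 / dedekindEta (16 * τ) ^ 6
      = (1 - xFun τ) / (1 + xFun τ) := by
  set q := Complex.exp (2 * Real.pi * Complex.I * τ) with hq
  set r := Complex.exp (2 * Real.pi * Complex.I * τ / 24) with hr
  have hr0 : r ≠ 0 := Complex.exp_ne_zero _
  have hq0 : q ≠ 0 := Complex.exp_ne_zero _
  have hrq : r ^ 24 = q := by
    rw [hr, hq, ← Complex.exp_nat_mul]; congr 1; push_cast; ring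
  have hq1 : ‖q‖ < 1 := UpperHalfPlane.norm_exp_two_pi_I_lt_one ⟨τ, hτ⟩
  have hη (n : ℕ) : dedekindEta (n * τ) = r ^ n * eulerProd (q ^ n) :=
    dedekindEta_natCast_mul n τ
  clear_value q r
  have h2 := hη 2
  have h4 := hη 4
  have h8 := hη 8
  have h16 := hη 16
  have h32 := hη 32
  push_cast at h2 h4 h8 h16 h32
  have hE (n : ℕ) (hn : n ≠ 0) := eulerProd_ne_zero (norm_pow_lt_one hq1 hn)
  have E2 := hE 2 (by norm_num)
  have E4 := hE 4 (by norm_num)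
  have E8 := hE 8 (by norm_num)
  have E16 := hE 16 (by norm_num)
  have E32 := hE 32 (by norm_num)
  have hQ0 : q ^ 2 ≠ 0 := pow_ne_zero _ hq0
  have hQ := norm_pow_lt_one hq1 two_ne_zero
  have hR0 : q ^ 8 ≠ 0 := pow_ne_zero _ hq0
  have hR : ‖q ^ 8‖ < 1 := norm_pow_lt_one hq1 (by norm_num)
  obtain ⟨s1, s2⟩ := thetaSeries_sub_add hQ0 hQ
  have t1 := thetaSeries_one hQ0 hQ
  have t2 := thetaSeries_neg_one hQ0 hQ
  have t3 := thetaSeries_one hR0 hR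
  have t4 := thetaSeries_self hR0 hR
  simp only [← pow_mul, Nat.reduceMul] at s1 s2 t1 t2 t3 t4
  have hx : xFun τ = thetaSeries (-1) (q ^ 2) / thetaSeries 1 (q ^ 2) := by
    rw [xFun, h2, h4, h8, t1, t2]
    field_simp
  have n1 : thetaSeries 1 (q ^ 2) ≠ 0 := by
    rw [t1]
    exact div_ne_zero (pow_ne_zero _ E4) (mul_ne_zero (pow_ne_zero _ E2) (pow_ne_zero _ E8))
  have n3 : thetaSeries 1 (q ^ 8) ≠ 0 := by
    rw [t3]
    exact div_ne_zero (pow_ne_zero _ E16) (mul_ne_zero (pow_ne_zero _ E8) (pow_ne_zero _ E32))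
  have hrhs : (1 - xFun τ) / (1 + xFun τ)
      = q ^ 2 * thetaSeries (q ^ 8) (q ^ 8) / thetaSeries 1 (q ^ 8) := by
    have e1 : 1 - xFun τ = 2 * (q ^ 2 * thetaSeries (q ^ 8) (q ^ 8)) / thetaSeries 1 (q ^ 2) := by
      rw [hx, eq_div_iff n1, sub_mul, div_mul_cancel₀ _ n1, s1, s2]; ring
    have e2 : 1 + xFun τ = 2 * thetaSeries 1 (q ^ 8) / thetaSeries 1 (q ^ 2) := by
      rw [hx, eq_div_iff n1, add_mul, div_mul_cancel₀ _ n1, s1, s2]; ring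
    rw [e1, e2]
    field_simp
  have main : 2 * dedekindEta (8 * τ) ^ 2 * dedekindEta (32 * τ) ^ 4 / dedekindEta (16 * τ) ^ 6
      = (1 - xFun τ) / (1 + xFun τ) := by
    rw [hrhs, t3, t4, h8, h16, h32]
    generalize eulerProd (q ^ 8) = a at *
    generalize eulerProd (q ^ 16) = b at *
    generalize eulerProd (q ^ 32) = c at *
    rw [← hrq]
    field_simp
  refine ⟨?_, main⟩
  rw [← main, div_pow, mul_pow, mul_pow, ← Complex.ofReal_pow, Real.sq_sqrt (by norm_num)]
  push_cast
  ring
end
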